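/- arXiv:2406.02493 — 2 statements merged into one kernel-verified Lean document; each statement's English description precedes it below -/
import Mathlib

section
/- Let F = F̆(α_1,…,α_t) be a fence. (1) If x and y are unshared elements of the same segment S_i, then χ_x − χ_y ≡ 0, i.e. χ_x − χ_y lies in the ℝ-span of the toggleability statistics {T_p : p ∈ F}. (2) If α_i = 2 for all i ∈ {1,…,t}, then the antichain cardinality statistic χ := Σ_{p ∈ F} χ_p satisfies χ ≡ t/2, i.e. χ − t/2 lies in the ℝ-span of {T_p : p ∈ F}. -/
open scoped Classical

namespace Fence

/-- partial sums: `m α i = α 0 + ⋯ + α (i-1)` (the paper's `m_i`). -/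
def m (α : ℕ → ℕ) (i : ℕ) : ℕ := ∑ k ∈ Finset.range i, α k

/-- the number `n` of elements of the fence `F̆(α)`. -/
def nn (t : ℕ) (α : ℕ → ℕ) : ℕ := m α t - 1

/-- vertex type: index `0` is a dummy (used as sentinel for nonexistent elements);
the fence elements are the indices `1,…,nn t α`. -/
abbrev V (t : ℕ) (α : ℕ → ℕ) := Fin (nn t α + 1)

/-- the element `x_j` (1-based). -/
def xel (t : ℕ) (α : ℕ → ℕ) (j : ℕ) : V t α :=
  ⟨j % (nn t α + 1), Nat.mod_lt _ (Nat.succ_pos _)⟩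

/-- `p` is an actual element of the fence (not the dummy `0`). -/
def Elem (t : ℕ) (α : ℕ → ℕ) (p : V t α) : Prop := 1 ≤ (p : ℕ)

/-- the conditions on `(t, α)` for `F̆(α)` to be a fence. -/
def IsFence (t : ℕ) (α : ℕ → ℕ) : Prop :=
  2 ≤ t ∧ (∀ i < t, 1 ≤ α i) ∧ 2 ≤ α 0 ∧ 2 ≤ α (t - 1)

/-- the covering relation of the fence: `Cov t α a b` means `a ⋖ b`. -/
def Cov (t : ℕ) (α : ℕ → ℕ) (a b : V t α) : Prop :=
  ∃ i < t, ((i % 2 = 0 ∧ (b : ℕ) = (a : ℕ) + 1) ∨ (i % 2 = 1 ∧ (a : ℕ) = (b : ℕ) + 1)) ∧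
    m α i ≤ min (a : ℕ) (b : ℕ) ∧ min (a : ℕ) (b : ℕ) < m α (i + 1) ∧
    1 ≤ min (a : ℕ) (b : ℕ) ∧ max (a : ℕ) (b : ℕ) ≤ nn t α

/-- the order of the fence: reflexive–transitive closure of the covering relation. -/
def Le (t : ℕ) (α : ℕ → ℕ) : V t α → V t α → Prop := Relation.ReflTransGen (Cov t α)

/-- order ideals of the fence (as sets of actual elements, downward closed). -/
def IsIdeal (t : ℕ) (α : ℕ → ℕ) (I : Set (V t α)) : Prop :=
  (∀ p ∈ I, Elem t α p) ∧ ∀ a b : V t α, Le t α a b → b ∈ I → a ∈ I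

/-- `J t α` is the set of order ideals of the fence. -/
abbrev J (t : ℕ) (α : ℕ → ℕ) := {I : Set (V t α) // IsIdeal t α I}

/-- `p` is a maximal element of the set `I`. -/
def MaxIn (t : ℕ) (α : ℕ → ℕ) (I : Set (V t α)) (p : V t α) : Prop :=
  p ∈ I ∧ ∀ q ∈ I, Le t α p q → q = p

/-- `p` is a minimal element of the complement of `I` (among actual elements). -/
def MinOut (t : ℕ) (α : ℕ → ℕ) (I : Set (V t α)) (p : V t α) : Prop :=
  Elem t α p ∧ p ∉ I ∧ ∀ q : V t α, Elem t α q → q ∉ I → Le t α q p → q = p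

/-- the order-ideal indicator function `χ̂_p`. -/
noncomputable def chiHat (t : ℕ) (α : ℕ → ℕ) (p : V t α) (I : J t α) : ℝ :=
  if p ∈ I.1 then 1 else 0

/-- the antichain indicator function `χ_p`. -/
noncomputable def chi (t : ℕ) (α : ℕ → ℕ) (p : V t α) (I : J t α) : ℝ :=
  if MaxIn t α I.1 p then 1 else 0

/-- the toggleability statistic `T_p`. -/
noncomputable def Tg (t : ℕ) (α : ℕ → ℕ) (p : V t α) (I : J t α) : ℝ :=
  if MinOut t α I.1 p then 1 else if MaxIn t α I.1 p then -1 else 0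

/-- the antichain toggleability statistic `T_A`. -/
noncomputable def TA (t : ℕ) (α : ℕ → ℕ) (A : Set (V t α)) (I : J t α) : ℝ :=
  if ∀ p ∈ A, MinOut t α I.1 p then 1 else if ∀ p ∈ A, MaxIn t α I.1 p then -1 else 0

/-- `#[a,b]`: the number of elements `r` with `a ⊴ r ⊴ b`. -/
noncomputable def icard (t : ℕ) (α : ℕ → ℕ) (a b : V t α) : ℕ :=
  Set.ncard {r : V t α | Elem t α r ∧ Le t α a r ∧ Le t α r b}

/-- the span of the toggleability statistics `{T_p : p ∈ F}`. -/
noncomputable def ToggSpan (t : ℕ) (α : ℕ → ℕ) : Submodule ℝ (J t α → ℝ) :=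
  Submodule.span ℝ {f | ∃ p : V t α, Elem t α p ∧ f = Tg t α p}

/-- `f ≡ g`: `f - g` is an `ℝ`-linear combination of toggleability statistics. -/
def Equiv' (t : ℕ) (α : ℕ → ℕ) (f g : J t α → ℝ) : Prop := f - g ∈ ToggSpan t α

/-- statistics of the form `const + linear combination of toggleability statistics`. -/
noncomputable def ConstPlusTogg (t : ℕ) (α : ℕ → ℕ) : Submodule ℝ (J t α → ℝ) :=
  ToggSpan t α ⊔ Submodule.span ℝ {fun _ : J t α => (1 : ℝ)}

/-- the span of the antichain indicator functions `{χ_p : p ∈ F}`. -/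
noncomputable def chiSpan (t : ℕ) (α : ℕ → ℕ) : Submodule ℝ (J t α → ℝ) :=
  Submodule.span ℝ {f | ∃ p : V t α, Elem t α p ∧ f = chi t α p}

/-- the span of the order-ideal indicator functions `{χ̂_p : p ∈ F}`. -/
noncomputable def chiHatSpan (t : ℕ) (α : ℕ → ℕ) : Submodule ℝ (J t α → ℝ) :=
  Submodule.span ℝ {f | ∃ p : V t α, Elem t α p ∧ f = chiHat t α p}

/-- the antichain toggleability space `A_T(F)`. -/
noncomputable def AT (t : ℕ) (α : ℕ → ℕ) : Submodule ℝ (J t α → ℝ) :=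
  chiSpan t α ⊓ ConstPlusTogg t α

/-- the order ideal toggleability space `I_T(F)`. -/
noncomputable def IT (t : ℕ) (α : ℕ → ℕ) : Submodule ℝ (J t α → ℝ) :=
  chiHatSpan t α ⊓ ConstPlusTogg t α

/-- the shared element `s_i = x_{m_i}` (for `1 ≤ i ≤ t-1`); the sentinels `i = 0` and
`i = t` give the dummy vertex `0`, so statistics indexed by them vanish. -/
def sElx (t : ℕ) (α : ℕ → ℕ) (i : ℕ) : V t α := xel t α (m α i)

/-- 1-based index of the unshared element `s_{(i,j)}` (the `j`-th smallest unshared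
element of the segment `S_i`, in the order of the fence). -/
def uEl (α : ℕ → ℕ) (i j : ℕ) : ℕ :=
  if (i - 1) % 2 = 0 then m α (i - 1) + j else m α i - j

def uElx (t : ℕ) (α : ℕ → ℕ) (i j : ℕ) : V t α := xel t α (uEl α i j)

/-- 1-based index of the peak of segment `S_i` (sentinel `0` if it does not exist). -/
def peakN (t : ℕ) (α : ℕ → ℕ) (i : ℕ) : ℕ :=
  if i % 2 = 1 then (if i + 1 ≤ t then m α i else 0) else m α (i - 1)

/-- 1-based index of the valley of segment `S_i` (sentinel `0` if it does not exist). -/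
def valleyN (t : ℕ) (α : ℕ → ℕ) (i : ℕ) : ℕ :=
  if i % 2 = 1 then (if 2 ≤ i then m α (i - 1) else 0) else (if i + 1 ≤ t then m α i else 0)

def peakx (t : ℕ) (α : ℕ → ℕ) (i : ℕ) : V t α := xel t α (peakN t α i)
def valleyx (t : ℕ) (α : ℕ → ℕ) (i : ℕ) : V t α := xel t α (valleyN t α i)

/-- segment `S_i` has a peak. -/
def HasPeak (t i : ℕ) : Prop := i % 2 = 0 ∨ i + 1 ≤ t

/-- segment `S_i` has a valley. -/
def HasValley (t i : ℕ) : Prop := (i % 2 = 1 ∧ 2 ≤ i) ∨ (i % 2 = 0 ∧ i + 1 ≤ t)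

/-- `p` is a shared element of the fence. -/
def IsSharedElem (t : ℕ) (α : ℕ → ℕ) (p : V t α) : Prop :=
  ∃ i, 1 ≤ i ∧ i + 1 ≤ t ∧ p = sElx t α i

/-- `p` is a peak of the fence. -/
def IsPeakElem (t : ℕ) (α : ℕ → ℕ) (p : V t α) : Prop :=
  ∃ i, 1 ≤ i ∧ i + 1 ≤ t ∧ i % 2 = 1 ∧ p = sElx t α i

/-- span of the antichain indicators of the shared elements. -/
noncomputable def chiSharedSpan (t : ℕ) (α : ℕ → ℕ) : Submodule ℝ (J t α → ℝ) :=
  Submodule.span ℝ {f | ∃ i, 1 ≤ i ∧ i + 1 ≤ t ∧ f = chi t α (sElx t α i)}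

/-- span of the order-ideal indicators of the shared elements. -/
noncomputable def chiHatSharedSpan (t : ℕ) (α : ℕ → ℕ) : Submodule ℝ (J t α → ℝ) :=
  Submodule.span ℝ {f | ∃ i, 1 ≤ i ∧ i + 1 ≤ t ∧ f = chiHat t α (sElx t α i)}

theorem cov_elem {t : ℕ} {α : ℕ → ℕ} {a b : V t α} (h : Cov t α a b) :
    Elem t α a ∧ Elem t α b := by
  obtain ⟨i, hi, hd, h1, h2, h3, h4⟩ := h
  constructor <;> (simp only [Elem]; omega)

theorem le_elem {t : ℕ} {α : ℕ → ℕ} {a b : V t α} (h : Le t α a b) (hb : Elem t α b) :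
    Elem t α a := by
  induction h using Relation.ReflTransGen.head_induction_on with
  | refl => exact hb
  | head hc _ _ => exact (cov_elem hc).1

/-- rowmotion: `ρ(I)` is the order ideal generated by the minimal elements of the
complement of `I`. -/
noncomputable def rho (t : ℕ) (α : ℕ → ℕ) (I : J t α) : J t α :=
  ⟨{q | ∃ p : V t α, MinOut t α I.1 p ∧ Le t α q p}, by
    constructor
    · rintro q ⟨p, hp, hle⟩
      exact le_elem hle hp.1
    · rintro a b hab ⟨p, hp, hle⟩
      exact ⟨p, hp, Relation.ReflTransGen.trans hab hle⟩⟩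

/-- the (forward) orbit of `x` under `ρ`. -/
def orbit {X : Type*} (ρ : X → X) (x : X) : Set X := {y | ∃ k : ℕ, ρ^[k] x = y}

/-- `f` is `c`-mesic under `ρ`: the sum of `f` over each orbit is `c` times
the orbit size. -/
def IsMesic {X : Type*} (ρ : X → X) (f : X → ℝ) (c : ℝ) : Prop :=
  ∀ x : X, ∑ᶠ y ∈ orbit ρ x, f y = (orbit ρ x).ncard * c


theorem maxIn_iff {t : ℕ} {α : ℕ → ℕ} (I : J t α) (p : V t α) :
    MaxIn t α I.1 p ↔ p ∈ I.1 ∧ ∀ q, Cov t α p q → q ∉ I.1 := by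
  constructor
  · rintro ⟨h1, h2⟩
    refine ⟨h1, fun q hq hqI => ?_⟩
    have := h2 q hqI (Relation.ReflTransGen.single hq)
    subst this
    obtain ⟨i, hi, hd, _⟩ := hq
    omega
  · rintro ⟨h1, h2⟩
    refine ⟨h1, fun q hqI hle => ?_⟩
    rcases Relation.ReflTransGen.cases_head hle with h | ⟨c, hc, hcq⟩
    · exact h.symm
    · exact absurd (I.2.2 c q hcq hqI) (h2 c hc)

theorem minOut_iff {t : ℕ} {α : ℕ → ℕ} (I : J t α) (p : V t α) :
    MinOut t α I.1 p ↔ Elem t α p ∧ p ∉ I.1 ∧ ∀ q, Cov t α q p → q ∈ I.1 := by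
  constructor
  · rintro ⟨h0, h1, h2⟩
    refine ⟨h0, h1, fun q hq => ?_⟩
    by_contra hqI
    have := h2 q (cov_elem hq).1 hqI (Relation.ReflTransGen.single hq)
    subst this
    obtain ⟨i, hi, hd, _⟩ := hq
    omega
  · rintro ⟨h0, h1, h2⟩
    refine ⟨h0, h1, fun q _ hqI hle => ?_⟩
    rcases Relation.ReflTransGen.cases_tail hle with h | ⟨c, hqc, hc⟩
    · exact h.symm
    · exact absurd (I.2.2 q c hqc (h2 c hc)) hqI

theorem Tg_mem {t : ℕ} {α : ℕ → ℕ} {p : V t α} (hp : Elem t α p) :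
    Tg t α p ∈ ToggSpan t α := Submodule.subset_span ⟨p, hp, rfl⟩

/-- If `b` is the only upper cover of `a` and `a` the only lower cover of `b`,
then `χ_a - χ_b = T_b`. -/
theorem chi_sub_chi {t : ℕ} {α : ℕ → ℕ} {a b : V t α} (hab : Cov t α a b)
    (h1 : ∀ q, Cov t α a q → q = b) (h2 : ∀ q, Cov t α q b → q = a) :
    (fun I => chi t α a I - chi t α b I) = Tg t α b := by
  funext I
  have key : MinOut t α I.1 b ↔ MaxIn t α I.1 a := by
    rw [minOut_iff, maxIn_iff]
    constructor
    · rintro ⟨_, hb, h⟩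
      exact ⟨h a hab, fun q hq => by rw [h1 q hq]; exact hb⟩
    · rintro ⟨ha, h⟩
      exact ⟨(cov_elem hab).2, h b hab, fun q hq => by rw [h2 q hq]; exact ha⟩
  have key2 : MinOut t α I.1 b → ¬ MaxIn t α I.1 b := fun h h' => h.2.1 h'.1
  unfold chi Tg
  by_cases hm : MinOut t α I.1 b
  · have := key2 hm
    have := key.1 hm
    simp [*]
  · have : ¬ MaxIn t α I.1 a := fun h => hm (key.2 h)
    by_cases hb : MaxIn t α I.1 b <;> simp [*]

theorem m_mono (α : ℕ → ℕ) {i j : ℕ} (h : i ≤ j) : m α i ≤ m α j :=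
  Finset.sum_le_sum_of_subset (Finset.range_subset_range.2 h)

theorem m_succ (α : ℕ → ℕ) (i : ℕ) : m α (i + 1) = m α i + α i :=
  Finset.sum_range_succ _ _

theorem m_uniq (α : ℕ → ℕ) {i i' k : ℕ} (h1 : m α i ≤ k) (h2 : k < m α (i + 1))
    (h1' : m α i' ≤ k) (h2' : k < m α (i' + 1)) : i = i' := by
  rcases lt_trichotomy i i' with h | h | h
  · have := m_mono α (show i + 1 ≤ i' from h); omega
  · exact h
  · have := m_mono α (show i' + 1 ≤ i from h); omega

theorem xel_val {t : ℕ} {α : ℕ → ℕ} {j : ℕ} (h : j ≤ nn t α) : ((xel t α j : V t α) : ℕ) = j :=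
  Nat.mod_eq_of_lt (by omega)

theorem step_even {t : ℕ} {α : ℕ → ℕ} {s j : ℕ} (hs : s < t) (he : s % 2 = 0)
    (h1 : m α s + 1 ≤ j) (h2 : j + 1 < m α (s + 1)) :
    (fun I => chi t α (xel t α j) I - chi t α (xel t α (j + 1)) I) = Tg t α (xel t α (j + 1)) := by
  have hn : m α (s + 1) ≤ nn t α + 1 := by
    have := m_mono α (show s + 1 ≤ t from hs); unfold nn; omega
  have hj : ((xel t α j : V t α) : ℕ) = j := xel_val (by omega)
  have hj1 : ((xel t α (j + 1) : V t α) : ℕ) = j + 1 := xel_val (by omega)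
  apply chi_sub_chi
  · exact ⟨s, hs, by rw [hj, hj1]; omega⟩
  · rintro q ⟨i, hi, hd, h3, h4, h5, h6⟩
    apply Fin.ext
    have := m_uniq α (i := i) (i' := s) h3 h4 (by omega) (by omega)
    omega
  · rintro q ⟨i, hi, hd, h3, h4, h5, h6⟩
    apply Fin.ext
    rcases hd with hd | hd
    · omega
    · have := m_uniq α (i := i) (i' := s) h3 h4 (by omega) (by omega)
      omega

theorem step_odd {t : ℕ} {α : ℕ → ℕ} {s j : ℕ} (hs : s < t) (he : s % 2 = 1)
    (h1 : m α s + 1 ≤ j) (h2 : j + 1 < m α (s + 1)) :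
    (fun I => chi t α (xel t α (j + 1)) I - chi t α (xel t α j) I) = Tg t α (xel t α j) := by
  have hn : m α (s + 1) ≤ nn t α + 1 := by
    have := m_mono α (show s + 1 ≤ t from hs); unfold nn; omega
  have hj : ((xel t α j : V t α) : ℕ) = j := xel_val (by omega)
  have hj1 : ((xel t α (j + 1) : V t α) : ℕ) = j + 1 := xel_val (by omega)
  apply chi_sub_chi
  · exact ⟨s, hs, by rw [hj, hj1]; omega⟩
  · rintro q ⟨i, hi, hd, h3, h4, h5, h6⟩
    apply Fin.ext
    rcases hd with hd | hd
    · have := m_uniq α (i := i) (i' := s) h3 h4 (by omega) (by omega)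
      omega
    · omega
  · rintro q ⟨i, hi, hd, h3, h4, h5, h6⟩
    apply Fin.ext
    rcases hd with hd | hd
    · have := m_uniq α (i := i) (i' := s) h3 h4 (by omega) (by omega)
      omega
    · omega

theorem part_one_aux {t : ℕ} {α : ℕ → ℕ} {i : ℕ} (hi : 1 ≤ i) (hit : i ≤ t) (j : ℕ) (hj : 1 ≤ j)
    (hj' : j ≤ α (i - 1) - 1) :
    (fun I => chi t α (uElx t α i 1) I - chi t α (uElx t α i j) I) ∈ ToggSpan t α := by
  obtain ⟨s, rfl⟩ : ∃ s, i = s + 1 := ⟨i - 1, by omega⟩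
  simp only [Nat.add_sub_cancel] at hj'
  have hms := m_succ α s
  have hn : m α (s + 1) ≤ nn t α + 1 := by
    have := m_mono α (show s + 1 ≤ t from hit); unfold nn; omega
  induction j, hj using Nat.le_induction with
  | base =>
    convert Submodule.zero_mem (ToggSpan t α) using 1
    funext I; simp
  | succ j hj ih =>
    have ih := ih (by omega)
    have hstep : (fun I => chi t α (uElx t α (s + 1) j) I - chi t α (uElx t α (s + 1) (j + 1)) I)
        ∈ ToggSpan t α := by
      unfold uElx uEl
      simp only [Nat.add_sub_cancel]
      split_ifs with he
      · have := step_even (t := t) (α := α) (s := s) (j := m α s + j) (by omega) he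
          (by omega) (by omega)
        rw [← add_assoc, this]
        apply Tg_mem
        unfold Elem
        rw [xel_val (by omega)]; omega
      · have := step_odd (t := t) (α := α) (s := s) (j := m α (s + 1) - (j + 1)) (by omega)
          (by omega) (by omega) (by omega)
        rw [show m α (s + 1) - (j + 1) + 1 = m α (s + 1) - j by omega] at this
        rw [this]
        apply Tg_mem
        unfold Elem
        rw [xel_val (by omega)]; omega
    convert Submodule.add_mem _ ih hstep using 1
    funext I; simp

/-- membership of `x_j` in `I`, false out of range. -/
def InI {t : ℕ} {α : ℕ → ℕ} (I : J t α) (j : ℕ) : Prop := ∃ h : j < nn t α + 1, (⟨j, h⟩ : V t α) ∈ I.1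

theorem m_two {t : ℕ} {α : ℕ → ℕ} (h2 : ∀ i < t, α i = 2) {i : ℕ} (hi : i ≤ t) : m α i = 2 * i := by
  unfold m
  rw [Finset.sum_congr rfl (fun k hk => h2 k (by have := Finset.mem_range.1 hk; omega))]
  simp; omega

theorem cov_two {t : ℕ} {α : ℕ → ℕ} (ht : 1 ≤ t) (h2 : ∀ i < t, α i = 2) (a b : V t α) :
    Cov t α a b ↔ ((a : ℕ) / 2 % 2 = 0 ∧ 1 ≤ (a : ℕ) ∧ (b : ℕ) = a + 1) ∨
      ((b : ℕ) / 2 % 2 = 1 ∧ (a : ℕ) = b + 1) := by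
  have hn : nn t α = 2 * t - 1 := by unfold nn; rw [m_two h2 le_rfl]
  have ha := a.2
  have hb := b.2
  constructor
  · rintro ⟨i, hi, hd, h3, h4, h5, h6⟩
    rw [m_two h2 (by omega)] at h3
    rw [m_two h2 (by omega)] at h4
    rcases hd with hd | hd
    · left
      have : i = (a : ℕ) / 2 := by omega
      subst this; omega
    · right
      have : i = (b : ℕ) / 2 := by omega
      subst this; omega
  · rintro (⟨h, h', hd⟩ | ⟨h, hd⟩)
    · refine ⟨(a : ℕ) / 2, by omega, ?_⟩
      rw [m_two h2 (by omega), m_two h2 (by omega)]; omega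
    · refine ⟨(b : ℕ) / 2, by omega, ?_⟩
      rw [m_two h2 (by omega), m_two h2 (by omega)]; omega

theorem max_two {t : ℕ} {α : ℕ → ℕ} (ht : 1 ≤ t) (h2 : ∀ i < t, α i = 2) (I : J t α) {j : ℕ}
    (h1 : 1 ≤ j) (hj : j ≤ 2 * t - 1) :
    MaxIn t α I.1 (xel t α j) ↔ InI I j ∧ (j / 2 % 2 = 0 → ¬ InI I (j + 1)) ∧
      ((j - 1) / 2 % 2 = 1 → ¬ InI I (j - 1)) := by
  have hn : nn t α = 2 * t - 1 := by unfold nn; rw [m_two h2 le_rfl]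
  have hx : xel t α j = ⟨j, by omega⟩ := Fin.ext (xel_val (by omega))
  rw [maxIn_iff, hx]
  simp only [cov_two ht h2]
  constructor
  · rintro ⟨h, h'⟩
    refine ⟨⟨by omega, h⟩, ?_, ?_⟩
    · rintro hm ⟨hl, hI⟩
      exact h' _ (Or.inl ⟨hm, h1, rfl⟩) hI
    · rintro hm ⟨hl, hI⟩
      exact h' _ (Or.inr ⟨hm, by simp only; omega⟩) hI
  · rintro ⟨⟨_, h⟩, h3, h4⟩
    refine ⟨h, ?_⟩
    rintro ⟨q, hq⟩ (⟨ha, hb, hc⟩ | ⟨ha, hc⟩) hI <;> simp only at ha hc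
    · subst hc
      exact h3 ha ⟨hq, hI⟩
    · subst hc
      exact h4 ha ⟨hq, hI⟩

theorem min_two {t : ℕ} {α : ℕ → ℕ} (ht : 1 ≤ t) (h2 : ∀ i < t, α i = 2) (I : J t α) {j : ℕ}
    (h1 : 1 ≤ j) (hj : j ≤ 2 * t - 1) :
    MinOut t α I.1 (xel t α j) ↔ ¬ InI I j ∧ (j / 2 % 2 = 1 → j + 1 ≤ 2 * t - 1 → InI I (j + 1)) ∧
      ((j - 1) / 2 % 2 = 0 → 2 ≤ j → InI I (j - 1)) := by
  have hn : nn t α = 2 * t - 1 := by unfold nn; rw [m_two h2 le_rfl]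
  have hx : xel t α j = ⟨j, by omega⟩ := Fin.ext (xel_val (by omega))
  rw [minOut_iff, hx]
  simp only [cov_two ht h2]
  constructor
  · rintro ⟨_, h, h'⟩
    refine ⟨fun hh => h hh.2, ?_, ?_⟩
    · intro hm hl
      exact ⟨by omega, h' _ (Or.inr ⟨hm, rfl⟩)⟩
    · intro hm hl
      exact ⟨by omega, h' _ (Or.inl ⟨hm, by simp only; omega, by simp only; omega⟩)⟩
  · rintro ⟨h, h3, h4⟩
    refine ⟨h1, fun hh => h ⟨_, hh⟩, ?_⟩
    rintro ⟨q, hq⟩ (⟨ha, hb, hc⟩ | ⟨ha, hc⟩) <;> simp only at ha hc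
    · subst hc
      exact (h4 ha (by simp only at hb; omega)).2
    · subst hc
      exact (h3 ha (by omega)).2

theorem inI_down {t : ℕ} {α : ℕ → ℕ} (ht : 1 ≤ t) (h2 : ∀ i < t, α i = 2) (I : J t α) {j : ℕ}
    (h1 : 1 ≤ j) (hm : j / 2 % 2 = 0) (h : InI I (j + 1)) : InI I j := by
  obtain ⟨h, hI⟩ := h
  refine ⟨by omega, I.2.2 _ _ (Relation.ReflTransGen.single ?_) hI⟩
  rw [cov_two ht h2]
  exact Or.inl ⟨hm, h1, rfl⟩

theorem inI_up {t : ℕ} {α : ℕ → ℕ} (ht : 1 ≤ t) (h2 : ∀ i < t, α i = 2) (I : J t α) {j : ℕ}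
    (hj : j + 1 ≤ 2 * t - 1) (hm : j / 2 % 2 = 1) (h : InI I j) : InI I (j + 1) := by
  have hn : nn t α = 2 * t - 1 := by unfold nn; rw [m_two h2 le_rfl]
  obtain ⟨h, hI⟩ := h
  refine ⟨by omega, I.2.2 _ _ (Relation.ReflTransGen.single ?_) hI⟩
  rw [cov_two ht h2]
  exact Or.inr ⟨hm, rfl⟩

theorem inI_range {t : ℕ} {α : ℕ → ℕ} (h2 : ∀ i < t, α i = 2) (I : J t α) {j : ℕ}
    (h : InI I j) : 1 ≤ j ∧ j ≤ 2 * t - 1 := by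
  have hn : nn t α = 2 * t - 1 := by unfold nn; rw [m_two h2 le_rfl]
  obtain ⟨h, hI⟩ := h
  have := I.2.1 _ hI
  unfold Elem at this
  simp only at this
  omega

/-- coefficients of the toggleability statistics. -/
noncomputable def cf (j : ℕ) : ℝ := if j % 2 = 1 then 1 / 2 else if j % 4 = 0 then 1 else 0

/-- correction terms at the shared elements. -/
noncomputable def gg {t : ℕ} {α : ℕ → ℕ} (I : J t α) (i : ℕ) : ℝ :=
  if i = 0 ∨ i = t then 0 else if i % 2 = 1 then (if InI I (2 * i) then 1 else 0)
  else (if InI I (2 * i) then 0 else 1)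

noncomputable def hh {t : ℕ} {α : ℕ → ℕ} (I : J t α) (j : ℕ) : ℝ :=
  chi t α (xel t α j) I + cf j * Tg t α (xel t α j) I

theorem hh_shared {t : ℕ} {α : ℕ → ℕ} (ht : 1 ≤ t) (h2 : ∀ i < t, α i = 2) (I : J t α) {i : ℕ}
    (hi : 1 ≤ i) (hit : i < t) : hh I (2 * i) = gg I i := by
  unfold hh gg chi Tg cf
  rw [if_neg (by omega : ¬ (i = 0 ∨ i = t))]
  rw [if_neg (by omega : ¬ (2 * i % 2 = 1))]
  have hM := max_two ht h2 I (j := 2 * i) (by omega) (by omega)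
  have hm := min_two ht h2 I (j := 2 * i) (by omega) (by omega)
  rcases Nat.mod_two_eq_zero_or_one i with he | he
  · rw [if_pos (by omega : 2 * i % 4 = 0), if_neg (by omega : ¬ i % 2 = 1)]
    have h5 : ¬ MinOut t α I.1 (xel t α (2 * i)) ↔ InI I (2 * i) := by
      rw [hm]
      constructor
      · intro h; by_contra h'
        exact h ⟨h', fun _ => by omega, fun _ => by omega⟩
      · intro h h'; exact h'.1 h
    by_cases h : InI I (2 * i)
    · rw [if_neg (h5.2 h), if_pos h]
      split_ifs <;> norm_num
    · have h6 : MinOut t α I.1 (xel t α (2 * i)) := by by_contra h'; exact h (h5.1 h')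
      have h7 : ¬ MaxIn t α I.1 (xel t α (2 * i)) := fun h' => h (hM.1 h').1
      rw [if_pos h6, if_neg h7, if_neg h]; norm_num
  · rw [if_neg (by omega : ¬ 2 * i % 4 = 0), if_pos he, zero_mul, add_zero]
    have : MaxIn t α I.1 (xel t α (2 * i)) ↔ InI I (2 * i) := by
      rw [hM]
      exact ⟨fun h => h.1, fun h => ⟨h, fun _ => by omega, fun _ => by omega⟩⟩
    simp only [this]

theorem hh_unshared {t : ℕ} {α : ℕ → ℕ} (ht : 1 ≤ t) (h2 : ∀ i < t, α i = 2) (I : J t α) {i : ℕ}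
    (hit : i < t) : hh I (2 * i + 1) = 1 / 2 * (1 - gg I i - gg I (i + 1)) := by
  have hM := max_two ht h2 I (j := 2 * i + 1) (by omega) (by omega)
  have hm := min_two ht h2 I (j := 2 * i + 1) (by omega) (by omega)
  have hr := inI_range h2 I (j := 2 * i + 2)
  have hr' := inI_range h2 I (j := 2 * i)
  simp only [Nat.add_sub_cancel] at hM hm
  unfold hh chi Tg cf
  rw [if_pos (by omega : (2 * i + 1) % 2 = 1)]
  rcases Nat.mod_two_eq_zero_or_one i with he | he
  · have d1 := inI_down ht h2 I (j := 2 * i + 1) (by omega) (by omega)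
    have d2 : 1 ≤ i → InI I (2 * i + 1) → InI I (2 * i) :=
      fun h => inI_down ht h2 I (j := 2 * i) (by omega) (by omega)
    have g1 : gg I i = if i = 0 ∨ InI I (2 * i) then 0 else 1 := by
      unfold gg; by_cases h0 : i = 0
      · simp [h0]
      · simp [h0, he, hit.ne]
    have g2 : gg I (i + 1) = if InI I (2 * i + 2) then 1 else 0 := by
      unfold gg
      by_cases h0 : i + 1 = t
      · have : ¬ InI I (2 * i + 2) := fun h => by have := hr h; omega
        simp [h0, this]
      · have h3 : (i + 1) % 2 = 1 := by omega
        simp [h0, h3, mul_add]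
    have hM' : MaxIn t α I.1 (xel t α (2 * i + 1)) ↔ InI I (2 * i + 1) ∧ ¬ InI I (2 * i + 2) := by
      rw [hM]
      exact ⟨fun h => ⟨h.1, h.2.1 (by omega)⟩, fun h => ⟨h.1, fun _ => h.2, fun _ => by omega⟩⟩
    have hm' : MinOut t α I.1 (xel t α (2 * i + 1)) ↔
        ¬ InI I (2 * i + 1) ∧ (i = 0 ∨ InI I (2 * i)) := by
      rw [hm]
      refine ⟨fun h => ⟨h.1, ?_⟩, fun h => ⟨h.1, fun _ => by omega, fun _ _ => ?_⟩⟩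
      · by_cases h0 : i = 0
        · exact Or.inl h0
        · exact Or.inr (h.2.2 (by omega) (by omega))
      · exact h.2.resolve_left (by omega)
    have d2' : InI I (2 * i + 1) → (i = 0 ∨ InI I (2 * i)) := fun h => by
      by_cases h0 : i = 0
      · exact Or.inl h0
      · exact Or.inr (d2 (by omega) h)
    rw [g1, g2]
    simp only [hM', hm']
    by_cases hP : (i = 0 ∨ InI I (2 * i)) <;> by_cases hQ : InI I (2 * i + 1) <;>
      by_cases hR : InI I (2 * i + 2) <;>
      first
      | exact absurd (d2' hQ) hP
      | exact absurd (d1 hR) hQ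
      | (simp only [hP, hQ, hR, if_true, if_false, not_true, not_false_iff, and_true, and_false]
         norm_num)
  · have d1 : 2 * i + 2 ≤ 2 * t - 1 → InI I (2 * i + 1) → InI I (2 * i + 2) :=
      fun h => inI_up ht h2 I (j := 2 * i + 1) (by omega) (by omega)
    have d2 : InI I (2 * i) → InI I (2 * i + 1) :=
      inI_up ht h2 I (j := 2 * i) (by omega) (by omega)
    have g1 : gg I i = if InI I (2 * i) then 1 else 0 := by
      have h0 : i ≠ 0 := by omega
      unfold gg; simp [h0, he, hit.ne]
    have g2 : gg I (i + 1) = if i + 1 = t ∨ InI I (2 * i + 2) then 0 else 1 := by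
      unfold gg
      by_cases h0 : i + 1 = t
      · simp [h0]
      · have h3 : (i + 1) % 2 = 0 := by omega
        simp [h0, h3, mul_add]
    have hM' : MaxIn t α I.1 (xel t α (2 * i + 1)) ↔ InI I (2 * i + 1) ∧ ¬ InI I (2 * i) := by
      rw [hM]
      exact ⟨fun h => ⟨h.1, h.2.2 (by omega)⟩, fun h => ⟨h.1, fun _ => by omega, fun _ => h.2⟩⟩
    have hm' : MinOut t α I.1 (xel t α (2 * i + 1)) ↔
        ¬ InI I (2 * i + 1) ∧ (i + 1 = t ∨ InI I (2 * i + 2)) := by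
      rw [hm]
      refine ⟨fun h => ⟨h.1, ?_⟩, fun h => ⟨h.1, fun _ _ => ?_, fun _ => by omega⟩⟩
      · by_cases h0 : i + 1 = t
        · exact Or.inl h0
        · exact Or.inr (h.2.1 (by omega) (by omega))
      · exact h.2.resolve_left (by omega)
    have d1' : InI I (2 * i + 1) → (i + 1 = t ∨ InI I (2 * i + 2)) := fun h => by
      by_cases h0 : i + 1 = t
      · exact Or.inl h0
      · exact Or.inr (d1 (by omega) h)
    rw [g1, g2]
    simp only [hM', hm']
    by_cases hP : (i + 1 = t ∨ InI I (2 * i + 2)) <;> by_cases hQ : InI I (2 * i + 1) <;>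
      by_cases hR : InI I (2 * i) <;>
      first
      | exact absurd (d1' hQ) hP
      | exact absurd (d2 hR) hQ
      | (simp only [hP, hQ, hR, if_true, if_false, not_true, not_false_iff, and_true, and_false]
         norm_num)

theorem hh_sum {t : ℕ} {α : ℕ → ℕ} (ht : 1 ≤ t) (h2 : ∀ i < t, α i = 2) (I : J t α) (k : ℕ)
    (hk : k + 1 ≤ t) :
    ∑ j ∈ Finset.range (2 * k + 1), hh I (j + 1) = ((k : ℝ) + 1) / 2 - gg I (k + 1) / 2 := by
  induction k with
  | zero =>
    have h := hh_unshared ht h2 I (i := 0) (by omega)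
    have g0 : gg I 0 = 0 := by simp [gg]
    rw [g0] at h
    simp only [mul_zero, zero_add] at h ⊢
    rw [Finset.sum_range_one, h]; push_cast; ring
  | succ k ih =>
    have ih := ih (by omega)
    rw [show 2 * (k + 1) + 1 = (2 * k + 1) + 1 + 1 by ring, Finset.sum_range_succ,
      Finset.sum_range_succ, ih]
    have h3 := hh_shared ht h2 I (i := k + 1) (by omega) (by omega)
    have h4 := hh_unshared ht h2 I (i := k + 1) (by omega)
    rw [show 2 * k + 1 + 1 = 2 * (k + 1) by ring, h3, h4]
    push_cast; ring

theorem sum_elem {t : ℕ} {α : ℕ → ℕ} (f : V t α → ℝ) :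
    ∑ p ∈ Finset.univ.filter (fun p : V t α => Elem t α p), f p =
      ∑ j ∈ Finset.range (nn t α), f (xel t α (j + 1)) := by
  symm
  apply Finset.sum_bij (fun j _ => xel t α (j + 1))
  · intro j hj
    have := Finset.mem_range.1 hj
    refine Finset.mem_filter.2 ⟨Finset.mem_univ _, ?_⟩
    unfold Elem
    rw [xel_val (by omega)]; omega
  · intro a ha b hb h
    have ha := Finset.mem_range.1 ha
    have hb := Finset.mem_range.1 hb
    have := congrArg Fin.val h
    rw [xel_val (by omega), xel_val (by omega)] at this
    omega
  · intro p hp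
    have hp : 1 ≤ (p : ℕ) := (Finset.mem_filter.1 hp).2
    have := p.2
    refine ⟨(p : ℕ) - 1, Finset.mem_range.2 (by omega), Fin.ext ?_⟩
    rw [xel_val (by omega)]; omega
  · intro j _; rfl

/-- Corollary `anti homom cor`.
(1) For unshared `x, y` in the same segment `S_i`, `χ_x − χ_y ≡ 0`.
(2) If `α_i = 2` for all `i`, the antichain cardinality statistic satisfies `χ ≡ t/2`. -/
theorem statement1 (t : ℕ) (α : ℕ → ℕ) (hF : IsFence t α) :
    (∀ i, 1 ≤ i → i ≤ t →
      ∀ j k, 1 ≤ j → j ≤ α (i - 1) - 1 → 1 ≤ k → k ≤ α (i - 1) - 1 →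
        Equiv' t α
          (fun I => chi t α (uElx t α i j) I - chi t α (uElx t α i k) I)
          (fun _ => (0 : ℝ)))
    ∧ ((∀ i < t, α i = 2) →
        Equiv' t α
          (fun I => ∑ p ∈ Finset.univ.filter (fun p : V t α => Elem t α p), chi t α p I)
          (fun _ => (t : ℝ) / 2)) := by
  constructor
  · intro i hi hit j k hj hj' hk hk'
    unfold Equiv'
    have h1 := part_one_aux (t := t) (α := α) hi hit j hj hj'
    have h2 := part_one_aux (t := t) (α := α) hi hit k hk hk'
    convert Submodule.sub_mem _ h2 h1 using 1
    funext I; simp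
  · intro h2
    have ht : 1 ≤ t := by have := hF.1; omega
    have hn : nn t α = 2 * t - 1 := by unfold nn; rw [m_two h2 le_rfl]
    unfold Equiv'
    have hmem : (∑ j ∈ Finset.range (nn t α), (-cf (j + 1)) • Tg t α (xel t α (j + 1)))
        ∈ ToggSpan t α := by
      refine Submodule.sum_mem _ fun j hj => Submodule.smul_mem _ _ (Tg_mem ?_)
      have := Finset.mem_range.1 hj
      unfold Elem
      rw [xel_val (by omega)]; omega
    convert hmem using 1
    funext I
    have hs := hh_sum ht h2 I (t - 1) (by omega)
    rw [show 2 * (t - 1) + 1 = nn t α by omega, show t - 1 + 1 = t by omega] at hs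
    have gt : gg I t = 0 := by simp [gg]
    rw [gt] at hs
    unfold hh at hs
    rw [Finset.sum_add_distrib] at hs
    simp only [Pi.sub_apply, Finset.sum_apply, Pi.smul_apply, smul_eq_mul, neg_mul,
      Finset.sum_neg_distrib]
    rw [sum_elem (fun p => chi t α p I)]
    push_cast [Nat.cast_sub ht] at hs
    linarith

end Fence
end

section
/- Let F = F̆(α_1,…,α_t) be a fence. The set X = {χ_{s_i} : 1 ≤ i ≤ t−1} of antichain indicator functions of the shared elements is linearly independent in the vector space of functions J(F) → ℝ, and the ℝ-span of X intersects the antichain toggleability space A_T(F) only in the zero function. -/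
open scoped Classical

namespace Fence

/-- closedness of an index predicate under the local order directions -/
def LIdeal (n : ℕ) (up : ℕ → Prop) (S : ℕ → Prop) : Prop :=
  ∀ j, 1 ≤ j → j + 1 ≤ n → (up j → S (j + 1) → S j) ∧ (¬ up j → S j → S (j + 1))

def LAdd (n : ℕ) (up : ℕ → Prop) (S : ℕ → Prop) (q : ℕ) : Prop :=
  1 ≤ q ∧ q ≤ n ∧ ¬ S q ∧ (2 ≤ q → up (q - 1) → S (q - 1)) ∧ (q + 1 ≤ n → ¬ up q → S (q + 1))

def LMax (n : ℕ) (up : ℕ → Prop) (S : ℕ → Prop) (q : ℕ) : Prop :=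
  1 ≤ q ∧ q ≤ n ∧ S q ∧ (2 ≤ q → ¬ up (q - 1) → ¬ S (q - 1)) ∧ (q + 1 ≤ n → up q → ¬ S (q + 1))

noncomputable def Ltm (n : ℕ) (up : ℕ → Prop) (w v : ℕ → ℝ) (S : ℕ → Prop) (q : ℕ) : ℝ :=
  (if LAdd n up S q then w q else 0) + (if LMax n up S q then v q else 0)

/-- abstract shared indices: places where the direction changes -/
def LSh (n : ℕ) (up : ℕ → Prop) (q : ℕ) : Prop :=
  2 ≤ q ∧ q + 1 ≤ n ∧ ¬ (up (q - 1) ↔ up q)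

theorem toggle_eq {n : ℕ} {up : ℕ → Prop} {w v : ℕ → ℝ} {C : ℝ}
    (h : ∀ S, LIdeal n up S → ∑ q ∈ Finset.range (n + 2), Ltm n up w v S q = C)
    (S : ℕ → Prop) (hS : LIdeal n up S) (k : ℕ) (hp : LAdd n up S (k + 1)) :
    (Ltm n up w v (fun x => S x ∨ x = k + 1) k - Ltm n up w v S k)
      + (v (k + 1) - w (k + 1))
      + (Ltm n up w v (fun x => S x ∨ x = k + 1) (k + 2) - Ltm n up w v S (k + 2)) = 0 := by
  set S' : ℕ → Prop := fun x => S x ∨ x = k + 1 with hS'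
  obtain ⟨h1, h2, h3, h4, h5⟩ := hp
  simp only [Nat.add_sub_cancel] at h4
  have hI : LIdeal n up S' := by
    intro j hj hjn
    obtain ⟨hu, hd⟩ := hS j hj hjn
    simp only [hS']
    refine ⟨fun a b => ?_, fun a b => ?_⟩
    · rcases b with b | b
      · exact Or.inl (hu a b)
      · obtain rfl : j = k := by omega
        exact Or.inl (h4 (by omega) a)
    · rcases b with b | b
      · exact Or.inl (hd a b)
      · subst b
        exact Or.inl (h5 hjn a)
  have e := h S' hI
  rw [← h S hS, ← sub_eq_zero, ← Finset.sum_sub_distrib] at e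
  have hsub : ({k, k + 1, k + 2} : Finset ℕ) ⊆ Finset.range (n + 2) := by
    intro x hx
    simp only [Finset.mem_insert, Finset.mem_singleton] at hx
    rw [Finset.mem_range]; omega
  rw [← Finset.sum_subset hsub] at e
  · rw [Finset.sum_insert (by simp), Finset.sum_insert (by simp), Finset.sum_singleton] at e
    have a1 : Ltm n up w v S' (k + 1) = v (k + 1) := by
      have na : ¬ LAdd n up S' (k + 1) := by
        rintro ⟨-, -, a, -⟩; exact a (Or.inr rfl)
      have nm : LMax n up S' (k + 1) := by
        refine ⟨h1, h2, Or.inr rfl, fun a b c => ?_, fun a b c => ?_⟩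
        · simp only [Nat.add_sub_cancel, hS'] at b c
          rcases c with c | c
          · exact h3 ((hS k (by omega) h2).2 b c)
          · omega
        · rcases c with c | c
          · exact h3 ((hS (k + 1) (by omega) a).1 b c)
          · omega
      simp [Ltm, na, nm]
    have a2 : Ltm n up w v S (k + 1) = w (k + 1) := by
      have na : LAdd n up S (k + 1) := ⟨h1, h2, h3, by simpa using h4, h5⟩
      have nm : ¬ LMax n up S (k + 1) := by
        rintro ⟨-, -, a, -⟩; exact h3 a
      simp [Ltm, na, nm]
    rw [a1, a2] at e
    linarith
  · intro x _ hx
    simp only [Finset.mem_insert, Finset.mem_singleton, not_or] at hx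
    have b0 : S' x = S x := by simp only [hS']; simp; omega
    have b1 : S' (x + 1) = S (x + 1) := by simp only [hS']; simp; omega
    have b2 : 2 ≤ x → S' (x - 1) = S (x - 1) := by intro _; simp only [hS']; simp; omega
    have c1 : LAdd n up S' x ↔ LAdd n up S x := by
      unfold LAdd; rw [b0, b1]
      constructor <;> rintro ⟨p1, p2, p3, p4, p5⟩ <;>
        exact ⟨p1, p2, p3, fun a b => by have := p4 a b; have := b2 a; simp_all, p5⟩
    have c2 : LMax n up S' x ↔ LMax n up S x := by
      unfold LMax; rw [b0, b1]
      constructor <;> rintro ⟨p1, p2, p3, p4, p5⟩ <;>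
        exact ⟨p1, p2, p3, fun a b => by have := p4 a b; have := b2 a; simp_all, p5⟩
    simp [Ltm, c1, c2]

/-- at a peak the addable weight vanishes, at a valley the maximal weight vanishes -/
theorem shared_eq {n : ℕ} {up : ℕ → Prop} {w v : ℕ → ℝ} {C : ℝ}
    (h : ∀ S, LIdeal n up S → ∑ q ∈ Finset.range (n + 2), Ltm n up w v S q = C)
    (s : ℕ) (hs : LSh n up s) :
    (up (s - 1) → w s = 0) ∧ (¬ up (s - 1) → v s = 0) := by
  obtain ⟨k, rfl⟩ : ∃ k, s = k + 2 := ⟨s - 2, by have := hs.1; omega⟩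
  obtain ⟨-, hn, hne⟩ := hs
  have hk1 : k + 2 - 1 = k + 1 := rfl
  rw [hk1] at *
  -- base ideals
  let S0 : ℕ → Prop := fun x => (k + 3 < x ∧ ¬ up (k + 3)) ∨ (x = k + 2 ∧ ¬ up (k + 1))
  let S1 : ℕ → Prop := fun x => S0 x ∨ x < k + 2
  have i0 : LIdeal n up S0 := by
    intro j hj hjn
    by_cases e1 : j = k + 3
    · subst e1; simp only [S0]; grind
    by_cases e2 : j = k + 2
    · subst e2; simp only [S0]; grind
    by_cases e3 : j = k + 1
    · subst e3; simp only [S0]; grind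
    simp only [S0]; grind
  have i1 : LIdeal n up S1 := by
    intro j hj hjn
    by_cases e1 : j = k + 3
    · subst e1; simp only [S1, S0]; grind
    by_cases e2 : j = k + 2
    · subst e2; simp only [S1, S0]; grind
    by_cases e3 : j = k + 1
    · subst e3; simp only [S1, S0]; grind
    simp only [S1, S0]; grind
  have a0 : LAdd n up S0 (k + 2 + 1) := by
    refine ⟨by omega, by omega, ?_, ?_, ?_⟩ <;> simp only [S0, Nat.add_sub_cancel] <;> grind
  have a1 : LAdd n up S1 (k + 2 + 1) := by
    refine ⟨by omega, by omega, ?_, ?_, ?_⟩ <;> simp only [S1, S0, Nat.add_sub_cancel] <;> grind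
  have e0 := toggle_eq h S0 i0 (k + 2) a0
  have e1 := toggle_eq h S1 i1 (k + 2) a1
  have r : ∀ (T T' : ℕ → Prop), (∀ x, k + 3 ≤ x → (T x ↔ T' x)) →
      Ltm n up w v T (k + 2 + 2) = Ltm n up w v T' (k + 2 + 2) := by
    intro T T' hT
    have p1 := hT (k + 3) (by omega)
    have p2 := hT (k + 4) (by omega)
    have p3 := hT (k + 5) (by omega)
    have q : k + 2 + 2 - 1 = k + 3 := rfl
    simp only [Ltm, LAdd, LMax, q]
    simp only [show k + 2 + 2 = k + 4 from rfl, show k + 4 + 1 = k + 5 from rfl, p1, p2, p3]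
  rw [r (fun x => S1 x ∨ x = k + 2 + 1) (fun x => S0 x ∨ x = k + 2 + 1)
      (by intro x hx; simp only [S1]; grind),
    r S1 S0 (by intro x hx; simp only [S1]; grind)] at e1
  have key : ∀ T : ℕ → Prop, (LAdd n up T (k+2) ↔ (¬ T (k+2) ∧ (up (k+1) → T (k+1)) ∧ (¬ up (k+2) → T (k+3))))
     ∧ (LMax n up T (k+2) ↔ (T (k+2) ∧ (¬ up (k+1) → ¬ T (k+1)) ∧ (up (k+2) → ¬ T (k+3)))) := by
    intro T
    unfold LAdd LMax
    simp only [show k + 2 + 1 = k + 3 from rfl]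
    grind
  simp only [Ltm.eq_1 n up w v _ (k+2), (key _).1, (key _).2, S1, S0] at e0 e1
  constructor
  · intro hu
    have hu2 : ¬ up (k + 2) := by tauto
    simp [hu, hu2] at e0 e1
    linarith
  · intro hu
    have hu2 : up (k + 2) := by tauto
    simp [hu, hu2] at e0 e1
    linarith

theorem max_principle {n : ℕ} (b : ℕ → ℝ) (h0 : b 0 = 0) (hn : b (n + 1) = 0)
    (hb : ∀ k, k + 1 ≤ n → b (k + 1) = 0 ∨ 2 * b (k + 1) = b k + b (k + 2)) :
    ∀ q, q ≤ n + 1 → b q ≤ 0 := by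
  by_contra hc
  push Not at hc
  obtain ⟨q, hq, hpos⟩ := hc
  obtain ⟨j, hj, hmax⟩ := Finset.exists_max_image (Finset.range (n + 2)) b ⟨0, by simp⟩
  have hM : 0 < b j := lt_of_lt_of_le hpos (hmax q (by simp; omega))
  have hex : ∃ i, i ≤ n + 1 ∧ b i = b j := ⟨j, by simp at hj; omega, rfl⟩
  obtain ⟨hi, hbi⟩ := Nat.find_spec hex
  have hmin := fun m => Nat.find_min hex (m := m)
  set i := Nat.find hex
  clear_value i
  have i0 : i ≠ 0 := by intro h; rw [h] at hbi; linarith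
  have i1 : i ≠ n + 1 := by intro h; rw [h] at hbi; linarith
  obtain ⟨k, hk⟩ : ∃ k, i = k + 1 := ⟨i - 1, by omega⟩
  subst hk
  have hle : b k ≤ b j := hmax k (by simp; omega)
  have hle2 : b (k + 2) ≤ b j := hmax (k + 2) (by simp; omega)
  have hne : b k ≠ b j := fun e => hmin k (by omega) ⟨by omega, e⟩
  have hlt := lt_of_le_of_ne hle hne
  rcases hb k (by omega) with e | e <;> linarith

theorem core {n : ℕ} {up : ℕ → Prop} {w v : ℕ → ℝ} {C : ℝ}
    (h : ∀ S, LIdeal n up S → ∑ q ∈ Finset.range (n + 2), Ltm n up w v S q = C)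
    (hu : ∀ q, 1 ≤ q → q ≤ n → ¬ LSh n up q → v q = - w q) :
    ∀ q, 1 ≤ q → q ≤ n → w q = 0 ∧ v q = 0 := by
  have hsh := fun s hs => shared_eq h s hs
  let b : ℕ → ℝ := fun q => if 1 ≤ q ∧ q ≤ n ∧ ¬ LSh n up q then w q else 0
  -- general toggle
  have tog : ∀ k, k + 1 ≤ n → ∃ S, LIdeal n up S ∧ LAdd n up S (k + 1) := by
    intro k hk
    refine ⟨fun x => (k + 1 < x ∧ ¬ up (k + 1)) ∨ (x < k + 1 ∧ up k), ?_, ?_⟩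
    · intro j hj hjn
      by_cases e1 : j = k
      · subst e1; grind
      by_cases e2 : j = k + 1
      · subst e2; grind
      grind
    · refine ⟨by omega, hk, ?_, ?_, ?_⟩ <;> simp only [Nat.add_sub_cancel] <;> grind
  have key : ∀ k, k + 1 ≤ n →
      (∃ S, LIdeal n up S ∧ LAdd n up S (k + 1) ∧
       (v (k + 1) - w (k + 1)) +
       (Ltm n up w v (fun x => S x ∨ x = k + 1) k - Ltm n up w v S k) +
       (Ltm n up w v (fun x => S x ∨ x = k + 1) (k + 2) - Ltm n up w v S (k + 2)) = 0) := by
    intro k hk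
    obtain ⟨S, h1, h2⟩ := tog k hk
    exact ⟨S, h1, h2, by linarith [toggle_eq h S h1 k h2]⟩
  -- effect on the left neighbour
  have left : ∀ k, k + 1 ≤ n → ∀ S, LIdeal n up S → LAdd n up S (k + 1) →
      (Ltm n up w v (fun x => S x ∨ x = k + 1) k - Ltm n up w v S k) = b k := by
    intro k hk S hS hp
    obtain ⟨h1, h2, h3, h4, h5⟩ := hp
    simp only [Nat.add_sub_cancel] at h4
    rcases k with _ | j
    · simp [Ltm, LAdd, LMax, b]
    have hI := hS (j + 1) (by omega) hk
    have hne : ¬ (j + 1 + 1 ≤ j + 1) := by omega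
    have q1 : j + 1 - 1 = j := rfl
    by_cases hup : up (j + 1)
    · have hSk : S (j + 1) := h4 (by omega) hup
      have c1 : ¬ LAdd n up (fun x => S x ∨ x = j + 1 + 1) (j + 1) := fun a => a.2.2.1 (Or.inl hSk)
      have c2 : ¬ LMax n up (fun x => S x ∨ x = j + 1 + 1) (j + 1) :=
        fun a => a.2.2.2.2 hk hup (Or.inr rfl)
      have c3 : ¬ LAdd n up S (j + 1) := fun a => a.2.2.1 hSk
      by_cases hs : LSh n up (j + 1)
      · have hv : v (j + 1) = 0 := (hsh _ hs).2 (by have := hs.2.2; tauto)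
        simp [Ltm, c1, c2, c3, b, hs, hv]
      · have c4 : LMax n up S (j + 1) := by
          refine ⟨by omega, by omega, hSk, fun a e => ?_, fun _ _ => h3⟩
          exact absurd ⟨a, hk, by tauto⟩ hs
        have hv := hu (j + 1) (by omega) (by omega) hs
        have : j + 1 ≤ n := by omega
        simp [Ltm, c1, c2, c3, c4, b, hs, hv, this]
    · have hSk : ¬ S (j + 1) := fun a => h3 (hI.2 hup a)
      have c1 : ¬ LMax n up (fun x => S x ∨ x = j + 1 + 1) (j + 1) := by
        rintro ⟨-, -, a | a, -⟩
        · exact hSk a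
        · omega
      have c2 : ¬ LAdd n up S (j + 1) := fun a => h3 (a.2.2.2.2 hk hup)
      have c3 : ¬ LMax n up S (j + 1) := fun a => hSk a.2.2.1
      by_cases hs : LSh n up (j + 1)
      · have hv : w (j + 1) = 0 := (hsh _ hs).1 (by have := hs.2.2; tauto)
        simp [Ltm, c1, c2, c3, b, hs, hv]
      · have c4 : LAdd n up (fun x => S x ∨ x = j + 1 + 1) (j + 1) := by
          refine ⟨by omega, by omega, ?_, fun a e => ?_, fun _ _ => Or.inr rfl⟩
          · rintro (a | a)
            · exact hSk a
            · omega
          · exact absurd ⟨a, hk, by tauto⟩ hs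
        have : j + 1 ≤ n := by omega
        simp [Ltm, c1, c2, c3, c4, b, hs, this]
  have right : ∀ k, k + 1 ≤ n → ∀ S, LIdeal n up S → LAdd n up S (k + 1) →
      (Ltm n up w v (fun x => S x ∨ x = k + 1) (k + 2) - Ltm n up w v S (k + 2)) = b (k + 2) := by
    intro k hk S hS hp
    obtain ⟨h1, h2, h3, h4, h5⟩ := hp
    by_cases hkn : k + 2 ≤ n
    swap
    · simp [Ltm, LAdd, LMax, b, hkn]
    have hI := hS (k + 1) (by omega) hkn
    have q1 : k + 2 - 1 = k + 1 := rfl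
    by_cases hup : up (k + 1)
    · have hSk : ¬ S (k + 2) := fun a => h3 (hI.1 hup a)
      have c1 : ¬ LMax n up (fun x => S x ∨ x = k + 1) (k + 2) := by
        rintro ⟨-, -, a | a, -⟩
        · exact hSk a
        · omega
      have c2 : ¬ LAdd n up S (k + 2) := fun a => h3 (a.2.2.2.1 (by omega) hup)
      have c3 : ¬ LMax n up S (k + 2) := fun a => hSk a.2.2.1
      by_cases hs : LSh n up (k + 2)
      · have hv : w (k + 2) = 0 := (hsh _ hs).1 hup
        simp [Ltm, c1, c2, c3, b, hs, hv]
      · have c4 : LAdd n up (fun x => S x ∨ x = k + 1) (k + 2) := by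
          refine ⟨by omega, by omega, ?_, fun _ _ => Or.inr rfl, fun a e => ?_⟩
          · rintro (a | a)
            · exact hSk a
            · omega
          · exact absurd ⟨by omega, a, by rw [q1]; tauto⟩ hs
        simp [Ltm, c1, c2, c3, c4, b, hs, hkn]
    · have hSk : S (k + 2) := h5 hkn hup
      have c1 : ¬ LAdd n up (fun x => S x ∨ x = k + 1) (k + 2) := fun a => a.2.2.1 (Or.inl hSk)
      have c2 : ¬ LMax n up (fun x => S x ∨ x = k + 1) (k + 2) :=
        fun a => a.2.2.2.1 (by omega) hup (Or.inr rfl)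
      have c3 : ¬ LAdd n up S (k + 2) := fun a => a.2.2.1 hSk
      by_cases hs : LSh n up (k + 2)
      · have hv : v (k + 2) = 0 := (hsh _ hs).2 hup
        simp [Ltm, c1, c2, c3, b, hs, hv]
      · have c4 : LMax n up S (k + 2) := by
          refine ⟨by omega, by omega, hSk, fun _ _ => h3, fun a e => ?_⟩
          exact absurd ⟨by omega, a, by rw [q1]; tauto⟩ hs
        have hv := hu (k + 2) (by omega) (by omega) hs
        simp [Ltm, c1, c2, c3, c4, b, hs, hv, hkn]
  have eqn : ∀ k, k + 1 ≤ n → w (k + 1) - v (k + 1) = b k + b (k + 2) := by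
    intro k hk
    obtain ⟨S, h1, h2, h3⟩ := key k hk
    rw [left k hk S h1 h2, right k hk S h1 h2] at h3
    linarith
  have b0 : b 0 = 0 := by simp [b]
  have bn : b (n + 1) = 0 := by simp [b]
  have hb : ∀ k, k + 1 ≤ n → b (k + 1) = 0 ∨ 2 * b (k + 1) = b k + b (k + 2) := by
    intro k hk
    by_cases hs : LSh n up (k + 1)
    · left; simp [b, hs]
    · right
      rw [← eqn k hk, hu (k + 1) (by omega) hk hs]
      simp only [b, hs]
      simp [hk]; ring
  have m1 := max_principle b b0 bn hb
  have m2 := max_principle (n := n) (fun q => - b q) (by simp [b0]) (by simp [bn]) (by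
    intro k hk
    rcases hb k hk with e | e
    · left; simp [e]
    · right; linarith)
  have bz : ∀ q, q ≤ n + 1 → b q = 0 := by
    intro q hq
    have := m1 q hq
    have := m2 q hq
    linarith
  intro q hq hqn
  obtain ⟨k, rfl⟩ : ∃ k, q = k + 1 := ⟨q - 1, by omega⟩
  have e := eqn k hqn
  rw [bz k (by omega), bz (k + 2) (by omega)] at e
  by_cases hs : LSh n up (k + 1)
  · obtain ⟨p1, p2⟩ := hsh _ hs
    by_cases hup : up (k + 1 - 1)
    · have := p1 hup
      exact ⟨this, by linarith⟩
    · have := p2 hup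
      exact ⟨by linarith, this⟩
  · have := hu (k + 1) (by omega) hqn hs
    exact ⟨by linarith, by linarith⟩

theorem m_mono_s3 (α : ℕ → ℕ) : Monotone (m α) :=
  monotone_nat_of_le_succ fun i => by rw [m_succ]; omega

/-- the fence goes up between indices `j` and `j+1` -/
def Up (t : ℕ) (α : ℕ → ℕ) (j : ℕ) : Prop :=
  ∃ i < t, i % 2 = 0 ∧ m α i ≤ j ∧ j < m α (i + 1)

theorem seg_unique {α : ℕ → ℕ} {i i' j : ℕ} (h1 : m α i ≤ j) (h2 : j < m α (i + 1))
    (h3 : m α i' ≤ j) (h4 : j < m α (i' + 1)) : i = i' := by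
  rcases lt_trichotomy i i' with h | h | h
  · have := m_mono_s3 α (show i + 1 ≤ i' from h); omega
  · exact h
  · have := m_mono_s3 α (show i' + 1 ≤ i from h); omega

theorem seg_exists {α : ℕ → ℕ} {j : ℕ} : ∀ t, j < m α t →
    ∃ i < t, m α i ≤ j ∧ j < m α (i + 1)
  | 0, h => by simp [m] at h
  | t + 1, h => by
    by_cases h' : j < m α t
    · obtain ⟨i, hi, h''⟩ := seg_exists t h'
      exact ⟨i, by omega, h''⟩
    · exact ⟨t, by omega, by omega, h⟩

theorem up_iff {t : ℕ} {α : ℕ → ℕ} {i j : ℕ} (hi : i < t) (h1 : m α i ≤ j)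
    (h2 : j < m α (i + 1)) : Up t α j ↔ i % 2 = 0 := by
  constructor
  · rintro ⟨i', _, h, h3, h4⟩
    rwa [seg_unique h1 h2 h3 h4]
  · intro h; exact ⟨i, hi, h, h1, h2⟩

theorem cov_iff {t : ℕ} {α : ℕ → ℕ} {a b : V t α} : Cov t α a b ↔
    1 ≤ (a : ℕ) ∧ 1 ≤ (b : ℕ) ∧ (((b : ℕ) = a + 1 ∧ Up t α a) ∨ ((a : ℕ) = b + 1 ∧ ¬ Up t α b)) := by
  have ha := a.2
  have hb := b.2
  have hn : nn t α = m α t - 1 := rfl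
  constructor
  · rintro ⟨i, hi, hd, h1, h2, h3, h4⟩
    refine ⟨by omega, by omega, ?_⟩
    rcases hd with ⟨e, hd⟩ | ⟨e, hd⟩
    · left
      rw [min_eq_left (by omega)] at h1 h2
      exact ⟨hd, (up_iff hi h1 h2).2 e⟩
    · right
      rw [min_eq_right (by omega)] at h1 h2
      exact ⟨hd, fun h => by have := (up_iff hi h1 h2).1 h; omega⟩
  · rintro ⟨ha1, hb1, ⟨e, hu⟩ | ⟨e, hu⟩⟩
    · obtain ⟨i, hi, h0, h1, h2⟩ := hu
      refine ⟨i, hi, Or.inl ⟨h0, e⟩, ?_, ?_, ?_, ?_⟩ <;> omega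
    · obtain ⟨i, hi, h1, h2⟩ := seg_exists (α := α) (j := (b : ℕ)) t (by omega)
      have := (up_iff hi h1 h2).not.1 hu
      refine ⟨i, hi, Or.inr ⟨by omega, e⟩, ?_, ?_, ?_, ?_⟩ <;> omega

def mkSet (t : ℕ) (α : ℕ → ℕ) (S : ℕ → Prop) : Set (V t α) := {p | 1 ≤ (p : ℕ) ∧ S p}

theorem mk_ideal {t : ℕ} {α : ℕ → ℕ} {S : ℕ → Prop} (hS : LIdeal (nn t α) (Up t α) S) :
    IsIdeal t α (mkSet t α S) := by
  refine ⟨fun p hp => hp.1, fun a b hab hb => ?_⟩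
  induction hab using Relation.ReflTransGen.head_induction_on with
  | refl => exact hb
  | @head x y hc _ ih =>
    obtain ⟨h1, h2, h | h⟩ := cov_iff.1 hc
    · refine ⟨h1, (hS _ h1 ?_).1 h.2 ?_⟩
      · have := y.2; omega
      · rw [← h.1]; exact ih.2
    · refine ⟨h1, ?_⟩
      have := (hS _ h2 (by have := x.2; omega)).2 h.2 ih.2
      rwa [← h.1] at this

theorem maxIn_iff_s3 {t : ℕ} {α : ℕ → ℕ} {S : ℕ → Prop} (hS : LIdeal (nn t α) (Up t α) S) (p : V t α) :
    MaxIn t α (mkSet t α S) p ↔ LMax (nn t α) (Up t α) S p := by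
  have hp := p.2
  constructor
  · rintro ⟨⟨h1, h2⟩, h3⟩
    refine ⟨h1, by omega, h2, fun a b c => ?_, fun a b c => ?_⟩
    · have := h3 ⟨(p : ℕ) - 1, by omega⟩ ⟨by simp only; omega, c⟩
        (Relation.ReflTransGen.single (cov_iff.2 ⟨h1, by simp only; omega,
          Or.inr ⟨by simp only; omega, b⟩⟩))
      have := congrArg Fin.val this
      simp only at this; omega
    · have := h3 ⟨(p : ℕ) + 1, by omega⟩ ⟨by simp only; omega, c⟩
        (Relation.ReflTransGen.single (cov_iff.2 ⟨h1, by simp only; omega,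
          Or.inl ⟨by simp only, b⟩⟩))
      have := congrArg Fin.val this
      simp only at this; omega
  · rintro ⟨h1, h2, h3, h4, h5⟩
    refine ⟨⟨h1, h3⟩, fun q hq hle => ?_⟩
    rcases Relation.ReflTransGen.cases_head hle with h | ⟨r, hr, hrq⟩
    · exact h.symm
    · exfalso
      have hrI := (mk_ideal hS).2 r q hrq hq
      have := r.2
      obtain ⟨k1, k2, k | k⟩ := cov_iff.1 hr
      · exact h5 (by omega) k.2 (by rw [← k.1]; exact hrI.2)
      · have e : (p : ℕ) - 1 = r := by omega
        exact h4 (by omega) (by rw [e]; exact k.2) (by rw [e]; exact hrI.2)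

theorem minOut_iff_s3 {t : ℕ} {α : ℕ → ℕ} {S : ℕ → Prop} (hS : LIdeal (nn t α) (Up t α) S) (p : V t α) :
    MinOut t α (mkSet t α S) p ↔ LAdd (nn t α) (Up t α) S p := by
  have hp := p.2
  constructor
  · rintro ⟨h1, h2, h3⟩
    have h1' : 1 ≤ (p : ℕ) := h1
    refine ⟨h1, by omega, fun h => h2 ⟨h1, h⟩, fun a b => ?_, fun a b => ?_⟩
    · by_contra c
      have := h3 ⟨(p : ℕ) - 1, by omega⟩ (by simp only [Elem]; omega) (fun h => c h.2)
        (Relation.ReflTransGen.single (cov_iff.2 ⟨by simp only; omega, h1,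
          Or.inl ⟨by simp only; omega, b⟩⟩))
      have := congrArg Fin.val this
      simp only at this; omega
    · by_contra c
      have := h3 ⟨(p : ℕ) + 1, by omega⟩ (by simp only [Elem]; omega) (fun h => c h.2)
        (Relation.ReflTransGen.single (cov_iff.2 ⟨by simp only; omega, h1,
          Or.inr ⟨by simp only, b⟩⟩))
      have := congrArg Fin.val this
      simp only at this; omega
  · rintro ⟨h1, h2, h3, h4, h5⟩
    refine ⟨h1, fun h => h3 h.2, fun q hq hqI hle => ?_⟩
    rcases Relation.ReflTransGen.cases_tail hle with h | ⟨r, hrq, hr⟩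
    · exact h.symm
    · exfalso
      refine hqI ((mk_ideal hS).2 q r hrq ?_)
      have := r.2
      obtain ⟨k1, k2, k | k⟩ := cov_iff.1 hr
      · have e : (p : ℕ) - 1 = r := by omega
        exact ⟨k1, by rw [← e]; exact h4 (by omega) (by rw [e]; exact k.2)⟩
      · exact ⟨k1, by rw [k.1]; exact h5 (by omega) k.2⟩

/-- main independence: no nontrivial combination of the shared indicators is
constant plus a combination of toggleability statistics -/
theorem indep (t : ℕ) (α : ℕ → ℕ) (hF : IsFence t α) (c : Fin (t - 1) → ℝ) (C : ℝ)
    (A : V t α → ℝ)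
    (h : ∀ I, ∑ i, c i * chi t α (sElx t α ((i : ℕ) + 1)) I = (∑ p, A p * Tg t α p I) + C) :
    ∀ i, c i = 0 := by
  obtain ⟨ht, hpos, h0, hlast⟩ := hF
  have hn : nn t α = m α t - 1 := rfl
  have hmt : m α t = m α (t - 1) + α (t - 1) := by
    rw [← m_succ, Nat.sub_add_cancel (by omega)]
  have hm1 : m α 1 = α 0 := by simp [m]
  -- position of the shared elements
  have hpos2 : ∀ i : Fin (t - 1), 2 ≤ m α ((i : ℕ) + 1) ∧ m α ((i : ℕ) + 1) + 1 ≤ nn t α := by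
    intro i
    have := m_mono_s3 α (show 1 ≤ (i : ℕ) + 1 by omega)
    have := m_mono_s3 α (show (i : ℕ) + 1 ≤ t - 1 by omega)
    omega
  have hval : ∀ i : Fin (t - 1), ((sElx t α ((i : ℕ) + 1) : V t α) : ℕ) = m α ((i : ℕ) + 1) := by
    intro i
    have := hpos2 i
    simp only [sElx, xel]
    exact Nat.mod_eq_of_lt (by omega)
  have hinj : Function.Injective (fun i : Fin (t - 1) => sElx t α ((i : ℕ) + 1)) := by
    intro i j hij
    have e := congrArg Fin.val hij
    simp only [hval] at e
    ext
    have hi : m α ((i : ℕ) + 1 + 1) = _ := m_succ α _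
    have hj : m α ((j : ℕ) + 1 + 1) = _ := m_succ α _
    have := hpos ((i : ℕ) + 1) (by omega)
    have := hpos ((j : ℕ) + 1) (by omega)
    have := seg_unique (α := α) (i := (i : ℕ) + 1) (i' := (j : ℕ) + 1) le_rfl
      (by omega) (by omega) (by omega)
    omega
  have hshared : ∀ i : Fin (t - 1), LSh (nn t α) (Up t α) (m α ((i : ℕ) + 1)) := by
    intro i
    obtain ⟨p1, p2⟩ := hpos2 i
    refine ⟨p1, p2, ?_⟩
    have a1 := hpos (i : ℕ) (by omega)
    have a2 := hpos ((i : ℕ) + 1) (by omega)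
    have b1 := m_succ α (i : ℕ)
    have b2 := m_succ α ((i : ℕ) + 1)
    rw [up_iff (i := (i : ℕ)) (by omega) (by omega) (by omega),
      up_iff (i := (i : ℕ) + 1) (by omega) le_rfl (by omega)]
    omega
  let c' : V t α → ℝ := fun q => ∑ i : Fin (t - 1), if sElx t α ((i : ℕ) + 1) = q then c i else 0
  let ext : (V t α → ℝ) → ℕ → ℝ := fun f q => if hq : q < nn t α + 1 then f ⟨q, hq⟩ else 0
  have hext : ∀ (f : V t α → ℝ) (p : V t α), ext f p = f p := by
    intro f p; simp only [ext]; rw [dif_pos p.2]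
  let w := ext (fun q => - A q)
  let v := ext (fun q => c' q + A q)
  have hsum : ∀ S, LIdeal (nn t α) (Up t α) S →
      ∑ q ∈ Finset.range (nn t α + 2), Ltm (nn t α) (Up t α) w v S q = C := by
    intro S hS
    have hh := h ⟨mkSet t α S, mk_ideal hS⟩
    rw [Finset.sum_range_succ]
    have z : Ltm (nn t α) (Up t α) w v S (nn t α + 1) = 0 := by simp [Ltm, LAdd, LMax]
    rw [z, add_zero, Finset.sum_range]
    have e1 : ∑ i, c i * chi t α (sElx t α ((i : ℕ) + 1)) ⟨mkSet t α S, mk_ideal hS⟩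
        = ∑ q, c' q * chi t α q ⟨mkSet t α S, mk_ideal hS⟩ := by
      simp only [c', Finset.sum_mul]
      rw [Finset.sum_comm]
      refine Finset.sum_congr rfl fun i _ => ?_
      simp only [ite_mul, zero_mul]
      rw [Finset.sum_ite_eq]
      simp
    rw [e1, ← sub_eq_iff_eq_add', ← Finset.sum_sub_distrib] at hh
    rw [← hh]
    refine Finset.sum_congr rfl fun q _ => ?_
    simp only [chi, Tg, maxIn_iff_s3 hS, minOut_iff_s3 hS, Ltm, w, v, hext]
    by_cases hA : LAdd (nn t α) (Up t α) S q
    · have hM : ¬ LMax (nn t α) (Up t α) S q := fun a => hA.2.2.1 a.2.2.1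
      simp [hA, hM]
    · by_cases hM : LMax (nn t α) (Up t α) S q <;> simp [hA, hM]
  have hu : ∀ q, 1 ≤ q → q ≤ nn t α → ¬ LSh (nn t α) (Up t α) q → v q = - w q := by
    intro q h1 h2 h3
    have hq : q < nn t α + 1 := by omega
    have z : c' ⟨q, hq⟩ = 0 := by
      refine Finset.sum_eq_zero fun i _ => if_neg fun e => h3 ?_
      have e' := congrArg Fin.val e
      rw [hval] at e'
      have := hshared i
      rwa [e'] at this
    simp [v, w, ext, h2, z]
  intro i
  have hi := hpos2 i
  obtain ⟨hw, hv⟩ := core hsum hu (m α ((i : ℕ) + 1)) (by omega) (by omega)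
  rw [← hval i] at hw hv
  simp only [w, v, hext] at hw hv
  have hc : c' (sElx t α ((i : ℕ) + 1)) = c i := by
    simp only [c']
    rw [Finset.sum_eq_single i]
    · simp
    · intro j _ hj
      exact if_neg fun e => hj (hinj e)
    · simp
  linarith

/-- Lemma `glc ac lemma`.
The antichain indicators `χ_{s_1},…,χ_{s_{t−1}}` of the shared elements are linearly
independent, and their span meets the antichain toggleability space `A_T(F)` trivially. -/
theorem statement3 (t : ℕ) (α : ℕ → ℕ) (hF : IsFence t α) :
    LinearIndependent ℝ (fun i : Fin (t - 1) => chi t α (sElx t α ((i : ℕ) + 1)))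
    ∧ Submodule.span ℝ
        (Set.range (fun i : Fin (t - 1) => chi t α (sElx t α ((i : ℕ) + 1)))) ⊓ AT t α = ⊥ := by
  constructor
  · rw [Fintype.linearIndependent_iff]
    intro c hc
    refine indep t α hF c 0 0 fun I => ?_
    have := congrFun hc I
    simpa using this
  · rw [eq_bot_iff]
    rintro f ⟨h1, -, h2⟩
    obtain ⟨c, rfl⟩ := (Submodule.mem_span_range_iff_exists_fun ℝ).1 h1
    obtain ⟨g, hg, k, hk, e⟩ := Submodule.mem_sup.1 h2
    obtain ⟨C, rfl⟩ := Submodule.mem_span_singleton.1 hk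
    have hg' : g ∈ Submodule.span ℝ (Set.range (Tg t α)) := by
      refine Submodule.span_mono ?_ hg
      rintro _ ⟨p, -, rfl⟩
      exact ⟨p, rfl⟩
    obtain ⟨A, rfl⟩ := (Submodule.mem_span_range_iff_exists_fun ℝ).1 hg'
    have hz := indep t α hF c C A fun I => by
      have := congrFun e I
      simpa using this.symm
    simp [hz]

end Fence
end
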